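/- Let 1 < q < 3, let b = sqrt(2/(3-q)) and ν = (3-q)/(q-1), and let Z have the standard Tsallis q-Gaussian distribution with parameter q, i.e., Z is distributed as b·T with T Student t with ν degrees of freedom. Then for every t ≠ 0, E[exp(i·t·Z)] = ((b·sqrt(ν)·|t|)^(ν/2) / (2^(ν/2 - 1)·Γ(ν/2))) · ∫₀^∞ exp(-b·sqrt(ν)·|t|·cosh(u))·cosh((ν/2)·u) du, the integral being the standard integral representation of K_{ν/2}(b·sqrt(ν)·|t|). -/

import Mathlib

open Real MeasureTheory Complex

lemma Real.range_const_mul_exp {c : ℝ} (hc : 0 < c) :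
    (fun u : ℝ => c * Real.exp u) '' Set.univ = Set.Ioi 0 := by
  ext y
  simp only [Set.image_univ, Set.mem_range, Set.mem_Ioi]
  refine ⟨?_, fun hy => ⟨Real.log (y / c), ?_⟩⟩
  · rintro ⟨u, rfl⟩
    positivity
  · rw [Real.exp_log (by positivity)]
    field_simp

lemma Real.integrableOn_rpow_mul_exp_neg_sub_div {α k : ℝ} (hα : 0 < α) (hk : 0 ≤ k) :
    IntegrableOn (fun y : ℝ => y ^ (α - 1) * Real.exp (-y - k / y)) (Set.Ioi 0) := by
  refine Integrable.mono' (Real.GammaIntegral_convergent hα)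
    (by fun_prop) ?_
  filter_upwards [ae_restrict_mem measurableSet_Ioi] with y hy
  have hy : 0 < y := hy
  have hky : 0 ≤ k / y := by positivity
  rw [Real.norm_of_nonneg (by positivity), mul_comm]
  gcongr
  linarith

/-- The substitution `y = (w / 2) * exp u` relates two integral representations of the modified
Bessel function of the second kind. -/
lemma Real.integral_rpow_mul_exp_neg_sub_div {α w : ℝ} (hα : 0 < α) (hw : 0 < w) :
    ∫ y in Set.Ioi (0 : ℝ), y ^ (α - 1) * Real.exp (-y - w ^ 2 / 4 / y) =
      2 * (w / 2) ^ α *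
        ∫ u in Set.Ioi (0 : ℝ), Real.exp (-w * Real.cosh u) * Real.cosh (α * u) := by
  have hw2 : 0 < w / 2 := by positivity
  have hderiv : ∀ u ∈ Set.univ, HasDerivWithinAt (fun u : ℝ => w / 2 * Real.exp u)
      (w / 2 * Real.exp u) Set.univ u := fun u _ =>
    ((Real.hasDerivAt_exp u).const_mul (w / 2)).hasDerivWithinAt
  have hinj : Set.InjOn (fun u : ℝ => w / 2 * Real.exp u) Set.univ := fun x _ y _ h =>
    Real.exp_injective (mul_left_cancel₀ hw2.ne' h)
  set G : ℝ → ℝ := fun u => Real.exp (-w * Real.cosh u) * Real.exp (α * u) with hG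
  have hsubst : ∀ u : ℝ, |w / 2 * Real.exp u| • ((w / 2 * Real.exp u) ^ (α - 1) *
      Real.exp (-(w / 2 * Real.exp u) - w ^ 2 / 4 / (w / 2 * Real.exp u))) =
      (w / 2) ^ α * G u := fun u => by
    have hpos : 0 < w / 2 * Real.exp u := by positivity
    have hexp : -(w / 2 * Real.exp u) - w ^ 2 / 4 / (w / 2 * Real.exp u) =
        -w * Real.cosh u := by
      rw [Real.cosh_eq, Real.exp_neg]
      field_simp
      ring
    rw [hexp, abs_of_pos hpos, smul_eq_mul, ← mul_assoc, Real.rpow_sub_one hpos.ne',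
      mul_div_cancel₀ _ hpos.ne', Real.mul_rpow hw2.le (Real.exp_pos u).le, ← Real.exp_mul,
      mul_comm u α, hG]
    ring
  have hint : Integrable G := by
    have h := Real.integrableOn_rpow_mul_exp_neg_sub_div (k := w ^ 2 / 4) hα (by positivity)
    rw [← Real.range_const_mul_exp hw2,
      integrableOn_image_iff_integrableOn_abs_deriv_smul MeasurableSet.univ hderiv hinj,
      integrableOn_univ] at h
    simp only [hsubst] at h
    exact (integrable_const_mul_iff (Ne.isUnit (by positivity)) _).1 h
  have hsplit : ∫ u, G u =
      2 * ∫ u in Set.Ioi (0 : ℝ), Real.exp (-w * Real.cosh u) * Real.cosh (α * u) := by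
    rw [← intervalIntegral.integral_Iic_add_Ioi (b := 0) hint.integrableOn hint.integrableOn,
      ← neg_zero, ← integral_comp_neg_Ioi, neg_zero,
      ← integral_add hint.comp_neg.integrableOn hint.integrableOn, ← integral_const_mul]
    congr 1 with u
    simp only [hG, Real.cosh_neg, mul_neg, Real.cosh_eq (α * u)]
    ring
  rw [mul_comm 2, mul_assoc, ← hsplit, ← Real.range_const_mul_exp hw2,
    integral_image_eq_integral_abs_deriv_smul MeasurableSet.univ hderiv hinj, setIntegral_univ]
  simp only [hsubst]
  rw [integral_const_mul]

lemma Complex.integral_cexp_mul_exp_neg_mul_sq {r : ℝ} (hr : 0 < r) (s : ℝ) :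
    ∫ x : ℝ, cexp (I * s * x) * (Real.exp (-r * x ^ 2) : ℝ) =
      (√(π / r) * Real.exp (-(s ^ 2 / (4 * r))) : ℝ) := by
  have h := fourierIntegral_gaussian (b := (r : ℂ)) (by simpa using hr) s
  push_cast
  rw [h, Real.sqrt_eq_rpow, ofReal_cpow (by positivity)]
  push_cast
  ring_nf

lemma Real.one_add_sq_div_rpow_neg_eq_integral {a c : ℝ} (ha : 0 < a) (hc : 0 < c) (x : ℝ) :
    (1 + x ^ 2 / c) ^ (-a) =
      (Real.Gamma a)⁻¹ *
        ∫ y in Set.Ioi (0 : ℝ), y ^ (a - 1) * Real.exp (-((1 + x ^ 2 / c) * y)) := by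
  have hpos : 0 < 1 + x ^ 2 / c := by positivity
  rw [Real.integral_rpow_mul_exp_neg_mul_Ioi ha hpos, one_div, Real.inv_rpow hpos.le,
    Real.rpow_neg hpos.le]
  have := (Real.Gamma_pos_of_pos ha).ne'
  field_simp

lemma Real.rpow_sub_one_mul_sqrt_div {a c y : ℝ} (hc : 0 ≤ c) (hy : 0 < y) :
    y ^ (a - 1) * √(π / (y / c)) = √(c * π) * y ^ (a - 1 / 2 - 1) := by
  have h : π / (y / c) = c * π / y := by field_simp
  rw [h, Real.sqrt_div (by positivity), Real.sqrt_eq_rpow y, mul_div_assoc', mul_comm,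
    mul_div_assoc, ← Real.rpow_sub hy]
  ring_nf

lemma integrable_cexp_mul_rpow_mul_exp {a c : ℝ} (ha : 1 / 2 < a) (hc : 0 < c) (s : ℝ) :
    Integrable (Function.uncurry fun x y : ℝ => cexp (I * s * x) *
      (y ^ (a - 1) * Real.exp (-((1 + x ^ 2 / c) * y)) : ℝ))
      (volume.prod (volume.restrict (Set.Ioi 0))) := by
  have hnorm : ∀ x y : ℝ, 0 < y → ‖cexp (I * s * x) *
      (y ^ (a - 1) * Real.exp (-((1 + x ^ 2 / c) * y)) : ℝ)‖ =
      y ^ (a - 1) * Real.exp (-y) * Real.exp (-(y / c) * x ^ 2) := fun x y hy => by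
    have h1 : ‖cexp (I * s * x)‖ = 1 := by
      have := Complex.norm_exp_ofReal_mul_I (s * x)
      rwa [show ((s * x : ℝ) : ℂ) * I = I * s * x by push_cast; ring] at this
    rw [norm_mul, h1, one_mul, Complex.norm_real, Real.norm_of_nonneg (by positivity), mul_assoc,
      ← Real.exp_add]
    ring_nf
  have hmeas : Measurable (Function.uncurry fun x y : ℝ => cexp (I * s * x) *
      (y ^ (a - 1) * Real.exp (-((1 + x ^ 2 / c) * y)) : ℝ)) := by
    unfold Function.uncurry
    fun_prop
  rw [integrable_prod_iff' hmeas.aestronglyMeasurable]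
  constructor
  · filter_upwards [ae_restrict_mem measurableSet_Ioi] with y hy
    refine (((integrable_exp_neg_mul_sq (div_pos hy hc)).const_mul
      (y ^ (a - 1) * Real.exp (-y)))).mono' ?_ (.of_forall fun x => (hnorm x y hy).le)
    exact (hmeas.comp measurable_prodMk_right).aestronglyMeasurable
  · refine ((Real.GammaIntegral_convergent (s := a - 1 / 2) (by linarith)).const_mul
      √(c * π)).congr ?_
    filter_upwards [ae_restrict_mem measurableSet_Ioi] with y hy
    have hy : 0 < y := hy
    simp only [Function.uncurry_apply_pair, hnorm _ y hy]
    rw [integral_const_mul, integral_gaussian]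
    linear_combination (-Real.exp (-y)) * Real.rpow_sub_one_mul_sqrt_div (a := a) hc.le hy

/-- The Fourier transform of `x ↦ (1 + x ^ 2 / c) ^ (-a)`, written as a Gamma mixture of Gaussian
Fourier transforms. -/
lemma integral_cexp_mul_one_add_sq_div_rpow_neg {a c : ℝ} (ha : 1 / 2 < a) (hc : 0 < c) (s : ℝ) :
    ∫ x : ℝ, cexp (I * s * x) * ((1 + x ^ 2 / c) ^ (-a) : ℝ) =
      ((Real.Gamma a)⁻¹ * (√(c * π) * ∫ y in Set.Ioi (0 : ℝ),
        y ^ (a - 1 / 2 - 1) * Real.exp (-y - (√c * |s|) ^ 2 / 4 / y)) : ℝ) := by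
  have hmix : ∀ x : ℝ, cexp (I * s * x) * ((1 + x ^ 2 / c) ^ (-a) : ℝ) =
      ((Real.Gamma a)⁻¹ : ℝ) * ∫ y in Set.Ioi (0 : ℝ), cexp (I * s * x) *
        (y ^ (a - 1) * Real.exp (-((1 + x ^ 2 / c) * y)) : ℝ) := fun x => by
    rw [Real.one_add_sq_div_rpow_neg_eq_integral (by linarith) hc, integral_const_mul,
      integral_complex_ofReal]
    push_cast
    ring
  simp only [hmix]
  rw [integral_const_mul, integral_integral_swap (integrable_cexp_mul_rpow_mul_exp ha hc s),
    Complex.ofReal_mul, ← integral_const_mul √(c * π), ← integral_complex_ofReal]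
  congr 1
  refine setIntegral_congr_fun measurableSet_Ioi fun y hy => ?_
  have hy : 0 < y := hy
  have hfactor : ∀ x : ℝ, cexp (I * s * x) *
      (y ^ (a - 1) * Real.exp (-((1 + x ^ 2 / c) * y)) : ℝ) =
      (y ^ (a - 1) * Real.exp (-y) : ℝ) *
        (cexp (I * s * x) * (Real.exp (-(y / c) * x ^ 2) : ℝ)) := fun x => by
    have : -((1 + x ^ 2 / c) * y) = -y + -(y / c) * x ^ 2 := by ring
    rw [this, Real.exp_add]
    push_cast
    ring
  simp only [hfactor]
  rw [integral_const_mul, Complex.integral_cexp_mul_exp_neg_mul_sq (by positivity),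
    ← Complex.ofReal_mul]
  congr 1
  have hexp : -y - (√c * |s|) ^ 2 / 4 / y = -y + -(s ^ 2 / (4 * (y / c))) := by
    rw [mul_pow, Real.sq_sqrt hc.le, sq_abs]
    field_simp
    ring
  rw [hexp, Real.exp_add]
  linear_combination (Real.exp (-y) * Real.exp (-(s ^ 2 / (4 * (y / c))))) *
    Real.rpow_sub_one_mul_sqrt_div (a := a) hc.le hy

/-- For `1 < q < 3`, the characteristic function of the standard Tsallis q-Gaussian `Z = b·T`
(with `T` Student t with `ν = (3-q)/(q-1)` degrees of freedom and `b = √(2/(3-q))`): for `t ≠ 0`,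
`E[exp(i·t·Z)] = ((b·√ν·|t|)^(ν/2) / (2^(ν/2-1)·Γ(ν/2))) · K_{ν/2}(b·√ν·|t|)`, the Bessel
function `K` being given by its standard integral representation. -/
theorem charFun_tsallis_qGaussian_one_lt_q
    {Ω : Type*} [MeasureSpace Ω] [IsProbabilityMeasure (volume : Measure Ω)]
    (q : ℝ) (hq1 : 1 < q) (hq3 : q < 3)
    (b : ℝ) (hb : b = Real.sqrt (2 / (3 - q)))
    (ν : ℝ) (hν : ν = (3 - q) / (q - 1))
    (T : Ω → ℝ) (hT : Measurable T)
    (hlaw : Measure.map T volume =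
      volume.withDensity (fun x => ENNReal.ofReal
        (Real.Gamma ((ν + 1) / 2) / (Real.sqrt (ν * π) * Real.Gamma (ν / 2)) *
          (1 + x ^ 2 / ν) ^ (-((ν + 1) / 2)))))
    (Z : Ω → ℝ) (hZ : ∀ ω, Z ω = b * T ω) :
    ∀ t : ℝ, t ≠ 0 →
      (∫ ω, Complex.exp (Complex.I * t * (Z ω)))
        = (((b * Real.sqrt ν * |t|) ^ (ν / 2) / ((2 : ℝ) ^ (ν / 2 - 1) * Real.Gamma (ν / 2))) *
            ∫ u in Set.Ioi (0 : ℝ),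
              Real.exp (-(b * Real.sqrt ν * |t|) * Real.cosh u) *
                Real.cosh ((ν / 2) * u) : ℝ) := by
  intro t ht
  have hν0 : 0 < ν := hν ▸ div_pos (by linarith) (by linarith)
  have hb0 : 0 < b := hb ▸ Real.sqrt_pos.2 (div_pos two_pos (by linarith))
  have hΓ1 : 0 < Real.Gamma ((ν + 1) / 2) := Real.Gamma_pos_of_pos (by positivity)
  have hΓ2 : 0 < Real.Gamma (ν / 2) := Real.Gamma_pos_of_pos (by positivity)
  have hw : 0 < √ν * |t * b| :=
    mul_pos (Real.sqrt_pos.2 hν0) (abs_pos.2 (mul_ne_zero ht hb0.ne'))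
  have hwb : b * √ν * |t| = √ν * |t * b| := by
    rw [abs_mul, abs_of_pos hb0]
    ring
  have hlhs : ∫ ω, cexp (I * t * (Z ω)) =
      ∫ x, cexp (I * (t * b : ℝ) * x) ∂(Measure.map T volume) := by
    rw [integral_map hT.aemeasurable (by fun_prop)]
    congr 1 with ω
    rw [hZ]
    push_cast
    ring_nf
  rw [hlhs, hlaw, integral_withDensity_eq_integral_toReal_smul (by fun_prop)
    (.of_forall fun _ => ENNReal.ofReal_lt_top)]
  have hdens : ∀ x : ℝ, (ENNReal.ofReal (Real.Gamma ((ν + 1) / 2) /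
      (√(ν * π) * Real.Gamma (ν / 2)) * (1 + x ^ 2 / ν) ^ (-((ν + 1) / 2)))).toReal •
        cexp (I * (t * b : ℝ) * x) =
      (Real.Gamma ((ν + 1) / 2) / (√(ν * π) * Real.Gamma (ν / 2)) : ℝ) *
        (cexp (I * (t * b : ℝ) * x) * ((1 + x ^ 2 / ν) ^ (-((ν + 1) / 2)) : ℝ)) := fun x => by
    rw [ENNReal.toReal_ofReal (by positivity), Complex.real_smul, Complex.ofReal_mul]
    ring
  simp only [hdens]
  rw [integral_const_mul, integral_cexp_mul_one_add_sq_div_rpow_neg (by linarith) hν0,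
    show (ν + 1) / 2 - 1 / 2 = ν / 2 by ring,
    Real.integral_rpow_mul_exp_neg_sub_div (by positivity) hw, hwb, ← Complex.ofReal_mul,
    Real.div_rpow hw.le two_pos.le, Real.rpow_sub_one two_ne_zero]
  congr 1
  have hsqrt : 0 < √(ν * π) := by positivity
  field_simp
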